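/- Let 𝒜 be an m-Enriques category with m ≥ 3/2 (m a half-integer, so 2m ≥ 3) admitting a semiorthogonal decomposition 𝒜 = ⟨𝒦, L₁, …, L_N⟩ with {L₁,…,L_N} an orthogonal exceptional collection, and let F be a (2m−1)-spherical object of 𝒦. Then there exists exactly one index i ∈ {1,…,N} with RHom(F, L_i) ≠ 0, and for that i, RHom(F, L_i) ≅ K[k−2m+1] ⊕ K[k] for some integer k. -/

import Mathlib

open CategoryTheory CategoryTheory.Limits CategoryTheory.Pretriangulated

universe v u

/-- A Serre functor on a `K`-linear category: an equivalence `S` with bifunctorial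
isomorphisms `Hom(A, B) ≅ Hom(B, S A)^∨`. -/
structure SerreFunctor (K : Type*) [Field K] (C : Type u) [Category.{v} C]
    [Preadditive C] [CategoryTheory.Linear K C] where
  S : C ⥤ C
  isEquiv : S.IsEquivalence
  pairing : ∀ A B : C, (A ⟶ B) ≃ₗ[K] Module.Dual K (B ⟶ S.obj A)
  natural : ∀ {A A' B B' : C} (h : A' ⟶ A) (f : B ⟶ B') (g : A ⟶ B)
    (φ : B' ⟶ S.obj A'),
    pairing A' B' (h ≫ g ≫ f) φ = pairing A B g (f ≫ φ ≫ S.map h)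

section PretriangulatedLemmas

variable {C : Type u} [Category.{v} C] [Preadditive C]

/-- Every morphism `A ⟶ B` is zero. -/
def HomZero (A B : C) : Prop := ∀ f : A ⟶ B, f = 0

lemma HomZero.of_iso {A A' B B' : C} (h : HomZero A B) (e : A ≅ A') (e' : B ≅ B') :
    HomZero A' B' := fun f => by
  have hf := h (e.hom ≫ f ≫ e'.inv)
  rw [← cancel_epi e.hom, ← cancel_mono e'.inv]
  simpa using hf

lemma finrank_hom_eq_zero_iff (K : Type*) [Field K] [CategoryTheory.Linear K C] {A B : C}
    [FiniteDimensional K (A ⟶ B)] :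
    Module.finrank K (A ⟶ B) = 0 ↔ HomZero A B := by
  rw [Module.finrank_zero_iff]
  exact ⟨fun _ _ => Subsingleton.elim _ _, fun h => ⟨fun a b => (h a).trans (h b).symm⟩⟩

section Shift

variable [HasShift C ℤ]

/-- The objects of the right orthogonal complement of the shifts of the objects `L i`. -/
def InPerp {ι : Type*} (L : ι → C) (X : C) : Prop := ∀ i (p : ℤ), HomZero ((L i)⟦p⟧) X

variable {ι : Type*} {L : ι → C}

lemma InPerp.of_iso {X Y : C} (h : InPerp L X) (e : X ≅ Y) : InPerp L Y :=
  fun i p => (h i p).of_iso (Iso.refl _) e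

variable [∀ n : ℤ, (shiftFunctor C n).Additive]

lemma homZero_shift_iff (p : ℤ) {A B : C} : HomZero (A⟦p⟧) (B⟦p⟧) ↔ HomZero A B := by
  constructor
  · intro h f
    exact (shiftFunctor C p).map_injective (by rw [h (f⟦p⟧'), Functor.map_zero])
  · intro h f
    obtain ⟨g, rfl⟩ := (shiftFunctor C p).map_surjective f
    rw [h g, Functor.map_zero]

lemma homZero_shift_shift_iff {p q r s : ℤ} (h : p + s = q + r) {A B : C} :
    HomZero (A⟦p⟧) (B⟦q⟧) ↔ HomZero (A⟦r⟧) (B⟦s⟧) := by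
  rw [← homZero_shift_iff (r - p)]
  have eA : (A⟦p⟧)⟦r - p⟧ ≅ A⟦r⟧ := ((shiftFunctorAdd' C p (r - p) r (by lia)).app A).symm
  have eB : (B⟦q⟧)⟦r - p⟧ ≅ B⟦s⟧ := ((shiftFunctorAdd' C q (r - p) s (by lia)).app B).symm
  exact ⟨fun H => H.of_iso eA eB, fun H => H.of_iso eA.symm eB.symm⟩

lemma homZero_shift_right_iff {p r : ℤ} (h : p + r = 0) {A B : C} :
    HomZero A (B⟦p⟧) ↔ HomZero (A⟦r⟧) B := by
  have eA := (shiftFunctorZero C ℤ).app A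
  have eB := (shiftFunctorZero C ℤ).app B
  have := homZero_shift_shift_iff (p := 0) (q := p) (r := r) (s := 0) (by lia) (A := A) (B := B)
  exact ⟨fun H => (this.1 (H.of_iso eA.symm (Iso.refl _))).of_iso (Iso.refl _) eB,
    fun H => (this.2 (H.of_iso (Iso.refl _) eB.symm)).of_iso eA (Iso.refl _)⟩

lemma InPerp.shift {X : C} (h : InPerp L X) (q : ℤ) : InPerp L (X⟦q⟧) := fun i p => by
  have H := (homZero_shift_iff q).2 (h i (p - q))
  exact H.of_iso ((shiftFunctorAdd' C (p - q) q p (by lia)).app (L i)).symm (Iso.refl _)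

lemma InPerp.of_shift {X : C} {q : ℤ} (h : InPerp L (X⟦q⟧)) : InPerp L X :=
  (h.shift (-q)).of_iso (shiftShiftNeg X q)

lemma InPerp.homZero_shift {X : C} (h : InPerp L X) (i : ι) (p : ℤ) :
    HomZero (L i) (X⟦p⟧) :=
  (h.shift p i 0).of_iso ((shiftFunctorZero C ℤ).app (L i)) (Iso.refl _)

lemma inPerp_of_homZero_shift {X : C} (h : ∀ i (p : ℤ), HomZero (L i) (X⟦p⟧)) : InPerp L X :=
  fun i p => (homZero_shift_right_iff (by lia)).1 (h i (-p))

variable [HasZeroObject C] [Pretriangulated C]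

section Exactness

variable {X Y Z W : C} {f : X ⟶ Y} {g : Y ⟶ Z} {h : Z ⟶ X⟦(1 : ℤ)⟧}

lemma exists_lift₂ (hT : Triangle.mk f g h ∈ distTriang C) (y : W ⟶ Y)
    (hy : y ≫ g = 0) : ∃ x : W ⟶ X, x ≫ f = y :=
  (Triangle.coyoneda_exact₂ _ hT y hy).imp fun _ => Eq.symm

lemma exists_lift₃ (hT : Triangle.mk f g h ∈ distTriang C) (z : W ⟶ Z)
    (hz : z ≫ h = 0) : ∃ y : W ⟶ Y, y ≫ g = z :=
  (Triangle.coyoneda_exact₃ _ hT z hz).imp fun _ => Eq.symm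

lemma exists_desc₁ (hT : Triangle.mk f g h ∈ distTriang C) (x : X⟦(1 : ℤ)⟧ ⟶ W)
    (hx : h ≫ x = 0) : ∃ y : Y⟦(1 : ℤ)⟧ ⟶ W, f⟦(1 : ℤ)⟧' ≫ y = x := by
  obtain ⟨y, hy⟩ := Triangle.yoneda_exact₃ _ (rot_of_distTriang _ hT) x hx
  exact ⟨-y, by
    rw [hy]
    exact (Preadditive.comp_neg _ _).trans (Preadditive.neg_comp _ _).symm⟩

lemma exists_desc₂ (hT : Triangle.mk f g h ∈ distTriang C) (y : Y ⟶ W)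
    (hy : f ≫ y = 0) : ∃ z : Z ⟶ W, g ≫ z = y :=
  (Triangle.yoneda_exact₂ _ hT y hy).imp fun _ => Eq.symm

lemma exists_desc₃ (hT : Triangle.mk f g h ∈ distTriang C) (z : Z ⟶ W)
    (hz : g ≫ z = 0) : ∃ x : X⟦(1 : ℤ)⟧ ⟶ W, h ≫ x = z :=
  (Triangle.yoneda_exact₃ _ hT z hz).imp fun _ => Eq.symm

end Exactness

lemma InPerp.of_distTriang {X Y Z : C} {f : X ⟶ Y} {g : Y ⟶ Z} {h : Z ⟶ X⟦(1 : ℤ)⟧}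
    (hT : Triangle.mk f g h ∈ distTriang C) (hX : InPerp L X) (hZ : InPerp L Z) :
    InPerp L Y := fun i p y => by
  obtain ⟨x, rfl⟩ := exists_lift₂ hT y (hZ i p _)
  rw [hX i p x, zero_comp]

variable {K : Type*} [Field K] [CategoryTheory.Linear K C]
  [∀ A B : C, FiniteDimensional K (A ⟶ B)]

lemma finrank_hom_le_of_distTriang {X Y Z : C} {f : X ⟶ Y} {g : Y ⟶ Z}
    {h : Z ⟶ X⟦(1 : ℤ)⟧} (hT : Triangle.mk f g h ∈ distTriang C) (W : C) :
    Module.finrank K (W ⟶ Y) ≤ Module.finrank K (W ⟶ X) + Module.finrank K (W ⟶ Z) := by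
  have h₁ := LinearMap.finrank_range_add_finrank_ker (Linear.rightComp K W g)
  have h₂ := Submodule.finrank_le (LinearMap.range (Linear.rightComp K W g))
  have h₃ : Module.finrank K (LinearMap.ker (Linear.rightComp K W g)) ≤
      Module.finrank K (W ⟶ X) := by
    refine (Submodule.finrank_mono fun y hy => ?_).trans
      (LinearMap.finrank_range_le (Linear.rightComp K W f))
    obtain ⟨x, rfl⟩ := exists_lift₂ hT y hy
    exact ⟨x, rfl⟩
  lia

lemma mor₃_eq_zero_of_retraction {X Y Z : C} {f : X ⟶ Y} {g : Y ⟶ Z}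
    {h : Z ⟶ X⟦(1 : ℤ)⟧} (hT : Triangle.mk f g h ∈ distTriang C) {r : Y ⟶ X}
    (hr : f ≫ r = 𝟙 X) : h = 0 := by
  have h₁ : h ≫ f⟦(1 : ℤ)⟧' = 0 := comp_distTriang_mor_zero₃₁ _ hT
  have h₂ := congrArg (· ≫ r⟦(1 : ℤ)⟧') h₁
  simpa [← Functor.map_comp, hr] using h₂

lemma finrank_hom_right_of_retraction {X Y Z : C} {f : X ⟶ Y} {g : Y ⟶ Z}
    {h : Z ⟶ X⟦(1 : ℤ)⟧} (hT : Triangle.mk f g h ∈ distTriang C) {r : Y ⟶ X}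
    (hr : f ≫ r = 𝟙 X) (W : C) :
    Module.finrank K (W ⟶ Y) = Module.finrank K (W ⟶ X) + Module.finrank K (W ⟶ Z) := by
  have hfg : f ≫ g = 0 := comp_distTriang_mor_zero₁₂ _ hT
  have hsurj : Function.Surjective (Linear.rightComp K W g) := fun z => by
    exact exists_lift₃ hT z (by simp [mor₃_eq_zero_of_retraction hT hr])
  have hinj : Function.Injective (Linear.rightComp K W f) := fun x y hxy => by
    have := congrArg (· ≫ r) hxy
    simpa [hr] using this
  have hker : LinearMap.ker (Linear.rightComp K W g) =
      LinearMap.range (Linear.rightComp K W f) := by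
    ext y
    constructor
    · intro hy
      obtain ⟨x, rfl⟩ := exists_lift₂ hT y hy
      exact ⟨x, rfl⟩
    · rintro ⟨x, rfl⟩
      simp [hfg]
  have h₁ := LinearMap.finrank_range_add_finrank_ker (Linear.rightComp K W g)
  rw [hker, LinearMap.finrank_range_of_inj hinj, LinearMap.range_eq_top.2 hsurj,
    finrank_top] at h₁
  lia

lemma finrank_hom_left_of_retraction {X Y Z : C} {f : X ⟶ Y} {g : Y ⟶ Z}
    {h : Z ⟶ X⟦(1 : ℤ)⟧} (hT : Triangle.mk f g h ∈ distTriang C) {r : Y ⟶ X}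
    (hr : f ≫ r = 𝟙 X) (W : C) :
    Module.finrank K (Y ⟶ W) = Module.finrank K (X ⟶ W) + Module.finrank K (Z ⟶ W) := by
  have hfg : f ≫ g = 0 := comp_distTriang_mor_zero₁₂ _ hT
  have hsurj : Function.Surjective (Linear.leftComp K W f) := fun x =>
    ⟨r ≫ x, by simp [reassoc_of% hr]⟩
  have hinj : Function.Injective (Linear.leftComp K W g) := by
    rw [← LinearMap.ker_eq_bot, LinearMap.ker_eq_bot']
    intro z hz
    obtain ⟨y, rfl⟩ := exists_desc₃ hT z hz
    simp [mor₃_eq_zero_of_retraction hT hr]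
  have hker : LinearMap.ker (Linear.leftComp K W f) =
      LinearMap.range (Linear.leftComp K W g) := by
    ext y
    constructor
    · intro hy
      obtain ⟨x, rfl⟩ := exists_desc₂ hT y hy
      exact ⟨x, rfl⟩
    · rintro ⟨x, rfl⟩
      simp [reassoc_of% hfg]
  have h₁ := LinearMap.finrank_range_add_finrank_ker (Linear.leftComp K W f)
  rw [hker, LinearMap.finrank_range_of_inj hinj, LinearMap.range_eq_top.2 hsurj,
    finrank_top] at h₁
  lia

variable (K) in
/-- `F` is an object of the orthogonal complement of `L` with one-dimensional endomorphism algebra,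
and `E` is numerically its Serre dual inside that complement. -/
structure IsSphericalPair (L : ι → C) (F E : C) : Prop where
  inPerp : InPerp L F
  finrank_end : Module.finrank K (F ⟶ F) = 1
  finrank_hom : Module.finrank K (F ⟶ E) = 1
  homZero_shift : HomZero F (E⟦(1 : ℤ)⟧)
  finrank_eq : ∀ X, InPerp L X → Module.finrank K (F ⟶ X) = Module.finrank K (X ⟶ E)

omit [HasShift C ℤ] [∀ n : ℤ, (shiftFunctor C n).Additive] [HasZeroObject C]
  [Pretriangulated C] [∀ A B : C, FiniteDimensional K (A ⟶ B)] in
lemma exists_smul_id_of_finrank_end {X : C} (h : Module.finrank K (X ⟶ X) = 1) (f : X ⟶ X) :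
    ∃ c : K, c • 𝟙 X = f := by
  refine exists_smul_eq_of_finrank_eq_one h (fun h₀ => ?_) f
  have : HomZero X X := fun x => by rw [← Category.comp_id x, h₀, comp_zero]
  have : Subsingleton (X ⟶ X) := ⟨fun a b => (this a).trans (this b).symm⟩
  rw [Module.finrank_zero_of_subsingleton] at h
  exact zero_ne_one h

namespace IsSphericalPair

variable {F E : C} (hF : IsSphericalPair K L F E)

include hF

lemma exists_comp_eq_shift {A : C} (hA : InPerp L A) {f : F ⟶ A⟦(1 : ℤ)⟧} (hf : f ≠ 0)
    (ε : F ⟶ E) : ∃ g : A⟦(1 : ℤ)⟧ ⟶ E, f ≫ g = ε := by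
  obtain ⟨B, a, b, hT⟩ := distinguished_cocone_triangle₂ f
  have hbf : b ≫ f = 0 := comp_distTriang_mor_zero₂₃ _ hT
  have hab : a ≫ b = 0 := comp_distTriang_mor_zero₁₂ _ hT
  by_contra hε
  have hbε : b ≫ ε ≠ 0 := fun h => hε (exists_desc₃ hT ε h)
  have hsurj₁ : Function.Surjective (Linear.rightComp K F a) := fun x => by
    refine exists_lift₂ hT x ?_
    obtain ⟨c, hc⟩ := exists_smul_id_of_finrank_end hF.finrank_end (x ≫ b)
    have hcf : c • f = 0 := by
      rw [← Category.id_comp f, ← Linear.smul_comp, hc, Category.assoc, hbf, comp_zero]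
    rw [← hc, (smul_eq_zero.1 hcf).resolve_right hf, zero_smul]
  have hsurj₂ : Function.Surjective (Linear.leftComp K E a) := fun y => by
    obtain ⟨z, hz⟩ := exists_desc₁ hT (y⟦(1 : ℤ)⟧') (hF.homZero_shift _)
    obtain ⟨z, rfl⟩ := (shiftFunctor C (1 : ℤ)).map_surjective z
    rw [← Functor.map_comp] at hz
    exact ⟨z, (shiftFunctor C (1 : ℤ)).map_injective hz⟩
  have h₁ := LinearMap.finrank_le_finrank_of_surjective hsurj₁
  have h₂ := LinearMap.finrank_range_add_finrank_ker (Linear.leftComp K E a)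
  rw [LinearMap.range_eq_top.2 hsurj₂, finrank_top] at h₂
  have h₃ : Module.finrank K (LinearMap.ker (Linear.leftComp K E a)) ≠ 0 := fun h => by
    rw [Submodule.finrank_eq_zero] at h
    have hmem : b ≫ ε ∈ LinearMap.ker (Linear.leftComp K E a) := by
      simp [reassoc_of% hab]
    rw [h, Submodule.mem_bot] at hmem
    exact hbε hmem
  have h₄ := hF.finrank_eq A hA
  have h₅ := hF.finrank_eq B (InPerp.of_distTriang hT hA hF.inPerp)
  lia

lemma exists_comp_eq {A : C} (hA : InPerp L A) {f : F ⟶ A} (hf : f ≠ 0) (ε : F ⟶ E) :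
    ∃ g : A ⟶ E, f ≫ g = ε := by
  let e := (shiftFunctor C (1 : ℤ)).objObjPreimageIso A
  obtain ⟨g, hg⟩ := hF.exists_comp_eq_shift (hA.of_iso e.symm).of_shift (f := f ≫ e.inv)
    (fun h => hf (by rwa [← cancel_mono e.inv, zero_comp])) ε
  exact ⟨e.inv ≫ g, by simpa using hg⟩

lemma exists_comp_ne_zero {A : C} (hA : InPerp L A) {g : A ⟶ E} (hg : g ≠ 0) :
    ∃ f : F ⟶ A, f ≫ g ≠ 0 := by
  have φ : (F ⟶ E) ≃ₗ[K] K :=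
    LinearEquiv.ofFinrankEq _ _ (by rw [hF.finrank_hom, Module.finrank_self])
  let Φ : (F ⟶ A) →ₗ[K] Module.Dual K (A ⟶ E) :=
    (Linear.comp F A E).compr₂ φ.toLinearMap
  have hinj : Function.Injective Φ := by
    rw [← LinearMap.ker_eq_bot, LinearMap.ker_eq_bot']
    intro f h
    by_contra hf
    obtain ⟨g, hg⟩ := hF.exists_comp_eq hA hf (φ.symm 1)
    have := LinearMap.congr_fun h g
    simp [Φ, hg] at this
  have hsurj : Function.Surjective Φ :=
    (LinearMap.injective_iff_surjective_of_finrank_eq_finrank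
      (by rw [Subspace.dual_finrank_eq, hF.finrank_eq A hA])).1 hinj
  by_contra! h
  refine hg ((Module.forall_dual_apply_eq_zero_iff K g).1 fun ℓ => ?_)
  obtain ⟨f, rfl⟩ := hsurj ℓ
  simp [Φ, h f]

lemma exists_comp_eq_of_shift {A : C} (hA : InPerp L A) {x : F⟦(1 : ℤ)⟧ ⟶ A} (hx : x ≠ 0)
    (ψ : F⟦(1 : ℤ)⟧ ⟶ E⟦(1 : ℤ)⟧) : ∃ g : A ⟶ E⟦(1 : ℤ)⟧, x ≫ g = ψ := by
  let e := (shiftFunctor C (1 : ℤ)).objObjPreimageIso A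
  obtain ⟨f, hf⟩ := (shiftFunctor C (1 : ℤ)).map_surjective (x ≫ e.inv)
  obtain ⟨ψ, rfl⟩ := (shiftFunctor C (1 : ℤ)).map_surjective ψ
  obtain ⟨g, hg⟩ := hF.exists_comp_eq (hA.of_iso e.symm).of_shift (f := f) (fun h => hx (by
    rw [← cancel_mono e.inv, ← hf, h, Functor.map_zero, zero_comp])) ψ
  exact ⟨e.inv ≫ g⟦(1 : ℤ)⟧', by
    rw [← Category.assoc, ← hf, ← Functor.map_comp, hg]⟩

lemma exists_shift_comp_ne_zero {A : C} (hA : InPerp L A) {g : A ⟶ E⟦(1 : ℤ)⟧} (hg : g ≠ 0) :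
    ∃ x : F⟦(1 : ℤ)⟧ ⟶ A, x ≫ g ≠ 0 := by
  let e := (shiftFunctor C (1 : ℤ)).objObjPreimageIso A
  obtain ⟨g', hg'⟩ := (shiftFunctor C (1 : ℤ)).map_surjective (e.hom ≫ g)
  obtain ⟨f, hf⟩ := hF.exists_comp_ne_zero (hA.of_iso e.symm).of_shift (g := g') (fun h => hg (by
    rw [← cancel_epi e.hom, ← hg', h, Functor.map_zero, comp_zero]))
  refine ⟨f⟦(1 : ℤ)⟧' ≫ e.hom, fun h => hf ((shiftFunctor C (1 : ℤ)).map_injective ?_)⟩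
  rw [Functor.map_comp, hg', ← Category.assoc, h, Functor.map_zero]

omit [HasZeroObject C] [Pretriangulated C] [∀ A B : C, FiniteDimensional K (A ⟶ B)] in
lemma exists_end_comp_eq {ψ : F⟦(1 : ℤ)⟧ ⟶ E⟦(1 : ℤ)⟧} (hψ : ψ ≠ 0)
    (ψ₀ : F⟦(1 : ℤ)⟧ ⟶ E⟦(1 : ℤ)⟧) : ∃ e : F⟦(1 : ℤ)⟧ ⟶ F⟦(1 : ℤ)⟧, e ≫ ψ = ψ₀ := by
  obtain ⟨ψ, rfl⟩ := (shiftFunctor C (1 : ℤ)).map_surjective ψ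
  obtain ⟨ψ₀, rfl⟩ := (shiftFunctor C (1 : ℤ)).map_surjective ψ₀
  have hψ' : ψ ≠ 0 := fun h => hψ (by rw [h, Functor.map_zero])
  obtain ⟨c, rfl⟩ := exists_smul_eq_of_finrank_eq_one hF.finrank_hom hψ' ψ₀
  exact ⟨(c • 𝟙 F)⟦(1 : ℤ)⟧', by
    rw [← Functor.map_comp, Linear.smul_comp, Category.id_comp]⟩

end IsSphericalPair

namespace SerreFunctor

variable (S : SerreFunctor K C) {A B : C}

omit [HasShift C ℤ] [∀ n : ℤ, (shiftFunctor C n).Additive] [HasZeroObject C]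
  [Pretriangulated C] [∀ A B : C, FiniteDimensional K (A ⟶ B)]

lemma pairing_apply (g : A ⟶ B) (φ : B ⟶ S.S.obj A) :
    S.pairing A B g φ = S.pairing A A (𝟙 A) (g ≫ φ) := by
  simpa using S.natural (𝟙 A) g (𝟙 A) φ

lemma exists_comp_ne_zero {g : A ⟶ B} (hg : g ≠ 0) : ∃ φ : B ⟶ S.S.obj A, g ≫ φ ≠ 0 := by
  by_contra! h
  refine hg ((S.pairing A B).map_eq_zero_iff.1 (LinearMap.ext fun φ => ?_))
  rw [pairing_apply, h φ, map_zero, LinearMap.zero_apply]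

lemma finrank_eq : Module.finrank K (A ⟶ B) = Module.finrank K (B ⟶ S.S.obj A) := by
  rw [(S.pairing A B).finrank_eq, Subspace.dual_finrank_eq]

lemma homZero_iff [∀ A B : C, FiniteDimensional K (A ⟶ B)] :
    HomZero A B ↔ HomZero B (S.S.obj A) := by
  rw [← finrank_hom_eq_zero_iff K, ← finrank_hom_eq_zero_iff K, S.finrank_eq]

end SerreFunctor

namespace IsSphericalPair

variable {S : SerreFunctor K C} {F E T A : C} (hF : IsSphericalPair K L F E)
  (κ : S.S.obj (S.S.obj F) ≅ E⟦(1 : ℤ)⟧) {w : S.S.obj F ⟶ F⟦(1 : ℤ)⟧} (hw : w ≠ 0)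

include hF κ hw

lemma comp_ne_zero_of_serre (hA : InPerp L A) {x : F⟦(1 : ℤ)⟧ ⟶ A} (hx : x ≠ 0) :
    w ≫ x ≠ 0 := by
  obtain ⟨ψ, hψ⟩ := S.exists_comp_ne_zero hw
  obtain ⟨g, hg⟩ := hF.exists_comp_eq_of_shift hA hx (ψ ≫ κ.hom)
  intro h
  apply hψ
  rw [← cancel_mono κ.hom, Category.assoc, ← hg, reassoc_of% h, zero_comp, zero_comp]

lemma exists_factor_of_serre (hA : InPerp L A) (y : S.S.obj F ⟶ A) :
    ∃ x : F⟦(1 : ℤ)⟧ ⟶ A, w ≫ x = y := by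
  by_contra! h
  have hy : y ∉ LinearMap.range (Linear.leftComp K A w) := fun ⟨x, hx⟩ => h x hx
  obtain ⟨ℓ, hℓy, hℓ⟩ := Submodule.exists_le_ker_of_notMem hy
  obtain ⟨φ, rfl⟩ : ∃ φ : A ⟶ S.S.obj (S.S.obj F),
      (S.pairing _ A).toLinearMap.flip φ = ℓ := by
    refine ⟨(Module.evalEquiv K _).symm (ℓ.comp (S.pairing _ A).symm.toLinearMap), ?_⟩
    ext z
    simp
  have hφ : φ ≫ κ.hom ≠ 0 := fun h₀ => hℓy (by
    have : φ = 0 := by rwa [← cancel_mono κ.hom, zero_comp]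
    rw [this, map_zero, LinearMap.zero_apply])
  obtain ⟨x, hx⟩ := hF.exists_shift_comp_ne_zero hA hφ
  obtain ⟨ψ, hψ⟩ : ∃ ψ, S.pairing _ _ w ψ ≠ 0 := by
    by_contra! h₀
    exact hw ((S.pairing _ _).map_eq_zero_iff.1 (LinearMap.ext h₀))
  obtain ⟨e, he⟩ := hF.exists_end_comp_eq hx (ψ ≫ κ.hom)
  have he' : e ≫ x ≫ φ = ψ := by
    rw [← cancel_mono κ.hom, ← he, Category.assoc, Category.assoc]
  have h₁ : S.pairing _ _ (w ≫ e ≫ x) φ = 0 := hℓ ⟨e ≫ x, rfl⟩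
  rw [S.pairing_apply, Category.assoc, Category.assoc, he', ← S.pairing_apply] at h₁
  exact hψ h₁

lemma homZero_of_distTriang {a : F ⟶ T} {b : T ⟶ S.S.obj F}
    (hT : Triangle.mk a b w ∈ distTriang C) (hA : InPerp L A) : HomZero T A := by
  intro t
  have hbw : b ≫ w = 0 := comp_distTriang_mor_zero₂₃ _ hT
  have hwa : w ≫ a⟦(1 : ℤ)⟧' = 0 := comp_distTriang_mor_zero₃₁ _ hT
  have hat : a ≫ t = 0 := by
    apply (shiftFunctor C (1 : ℤ)).map_injective
    rw [Functor.map_zero]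
    by_contra h
    refine hF.comp_ne_zero_of_serre κ hw (hA.shift 1) h ?_
    rw [Functor.map_comp, reassoc_of% hwa, zero_comp]
  obtain ⟨y, rfl⟩ := exists_desc₂ hT t hat
  obtain ⟨x, rfl⟩ := hF.exists_factor_of_serre κ hw hA y
  rw [reassoc_of% hbw, zero_comp]

end IsSphericalPair

variable (K) in
/-- An orthogonal exceptional collection. -/
structure IsOrthogonalExceptional (L : ι → C) : Prop where
  finrank_end : ∀ i, Module.finrank K (L i ⟶ L i) = 1
  homZero_shift : ∀ i (p : ℤ), p ≠ 0 → HomZero (L i) ((L i)⟦p⟧)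
  homZero_of_ne : ∀ i j, i ≠ j → ∀ p : ℤ, HomZero (L i) ((L j)⟦p⟧)

namespace IsOrthogonalExceptional

variable (hL : IsOrthogonalExceptional K L)

include hL

omit [HasZeroObject C] [Pretriangulated C] [∀ A B : C, FiniteDimensional K (A ⟶ B)] in
lemma homZero {i j : ι} {p q : ℤ} (h : ¬ (i = j ∧ p = q)) :
    HomZero ((L i)⟦p⟧) ((L j)⟦q⟧) := by
  rw [homZero_shift_shift_iff (r := 0) (s := q - p) (by lia)]
  refine HomZero.of_iso ?_ ((shiftFunctorZero C ℤ).app (L i)).symm (Iso.refl _)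
  by_cases hij : i = j
  · subst hij
    exact hL.homZero_shift i _ fun h₀ => h ⟨rfl, by lia⟩
  · exact hL.homZero_of_ne i j hij _

lemma exists_inPerp_distTriang (S : SerreFunctor K C) (i : ι) :
    ∃ (Q : C) (θ : L i ⟶ S.S.obj (L i)) (q : S.S.obj (L i) ⟶ Q) (d : Q ⟶ (L i)⟦(1 : ℤ)⟧),
      Triangle.mk θ q d ∈ distTriang C ∧ InPerp L Q := by
  have hrank : Module.finrank K (L i ⟶ S.S.obj (L i)) = 1 := by
    rw [← S.finrank_eq, hL.finrank_end]
  obtain ⟨θ, hθ, hθ'⟩ := finrank_eq_one_iff'.1 hrank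
  obtain ⟨Q, q, d, hT⟩ := distinguished_cocone_triangle θ
  have hθq : θ ≫ q = 0 := comp_distTriang_mor_zero₁₂ _ hT
  have hdθ : d ≫ θ⟦(1 : ℤ)⟧' = 0 := comp_distTriang_mor_zero₃₁ _ hT
  refine ⟨Q, θ, q, d, hT, fun j p z => ?_⟩
  have e₀ := (shiftFunctorZero C ℤ).app (L i)
  have hS : ¬ (i = j ∧ p = 0) → HomZero ((L j)⟦p⟧) (S.S.obj (L i)) := fun h =>
    S.homZero_iff.1 ((hL.homZero (q := p) (fun h' => h ⟨h'.1, h'.2.symm⟩)).of_iso e₀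
      (Iso.refl _))
  have hzd : z ≫ d = 0 := by
    by_cases h : j = i ∧ p = 1
    · obtain ⟨rfl, rfl⟩ := h
      obtain ⟨u, hu⟩ := (shiftFunctor C (1 : ℤ)).map_surjective (z ≫ d)
      obtain ⟨c, rfl⟩ := exists_smul_id_of_finrank_end (hL.finrank_end j) u
      have hcθ : c • θ = 0 := by
        apply (shiftFunctor C (1 : ℤ)).map_injective
        rw [← Category.id_comp θ, ← Linear.smul_comp, Functor.map_comp, hu, Category.assoc,
          hdθ, comp_zero, Functor.map_zero]
      rw [← hu, (smul_eq_zero.1 hcθ).resolve_right hθ, zero_smul, Functor.map_zero]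
    · exact hL.homZero h _
  obtain ⟨y, rfl⟩ := exists_lift₃ hT z hzd
  by_cases h : i = j ∧ p = 0
  · obtain ⟨rfl, rfl⟩ := h
    obtain ⟨c, hc⟩ := hθ' (e₀.inv ≫ y)
    rw [← cancel_epi e₀.inv, ← Category.assoc, ← hc, Linear.smul_comp, hθq, smul_zero, comp_zero]
  · rw [hS h y, zero_comp]

lemma exists_retraction (S : SerreFunctor K C) {i : ι} {p : ℤ} {X : C}
    (hX : ∀ A, InPerp L A → HomZero X A) {a : (L i)⟦p⟧ ⟶ X} (ha : a ≠ 0) :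
    ∃ r : X ⟶ (L i)⟦p⟧, a ≫ r = 𝟙 _ := by
  let e := (shiftFunctor C p).objObjPreimageIso X
  obtain ⟨a', ha'⟩ := (shiftFunctor C p).map_surjective (a ≫ e.inv)
  have hne : a' ≠ 0 := fun h => ha (by
    rw [← cancel_mono e.inv, ← ha', h, Functor.map_zero, zero_comp])
  obtain ⟨c, hc⟩ := S.exists_comp_ne_zero hne
  obtain ⟨Q, θ, q, d, hT, hQ⟩ := hL.exists_inPerp_distTriang S i
  have hcq : c ≫ q = 0 := (homZero_shift_iff p).1
    ((hX _ (hQ.shift p)).of_iso e.symm (Iso.refl _)) _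
  obtain ⟨b, rfl⟩ := exists_lift₂ hT c hcq
  obtain ⟨k, hk⟩ := exists_smul_id_of_finrank_end (hL.finrank_end i) (a' ≫ b)
  have hk₀ : k ≠ 0 := fun h₀ => hc (by
    rw [← Category.assoc, ← hk, h₀, zero_smul, zero_comp])
  refine ⟨e.inv ≫ (k⁻¹ • b)⟦p⟧', ?_⟩
  rw [← Category.assoc, ← ha', ← Functor.map_comp, Linear.comp_smul, ← hk,
    inv_smul_smul₀ hk₀, CategoryTheory.Functor.map_id]

lemma exists_summand (S : SerreFunctor K C) {X : C}
    (hX : ∀ A, InPerp L A → HomZero X A) (hX₀ : ¬ HomZero X X) :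
    ∃ (i : ι) (p : ℤ) (Y : C), (∀ A, InPerp L A → HomZero Y A) ∧
      (∀ W : C, Module.finrank K (W ⟶ X) =
        Module.finrank K (W ⟶ (L i)⟦p⟧) + Module.finrank K (W ⟶ Y)) ∧
      ∀ W : C, Module.finrank K (X ⟶ W) =
        Module.finrank K ((L i)⟦p⟧ ⟶ W) + Module.finrank K (Y ⟶ W) := by
  obtain ⟨i, p, a, ha⟩ : ∃ (i : ι) (p : ℤ) (a : (L i)⟦p⟧ ⟶ X), a ≠ 0 := by
    by_contra! h
    exact hX₀ (hX X h)
  obtain ⟨r, hr⟩ := hL.exists_retraction S hX ha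
  obtain ⟨Y, g, h, hT⟩ := distinguished_cocone_triangle a
  refine ⟨i, p, Y, fun A hA y => ?_, fun W => finrank_hom_right_of_retraction hT hr W,
    fun W => finrank_hom_left_of_retraction hT hr W⟩
  obtain ⟨x, rfl⟩ := exists_desc₃ hT y (hX A hA _)
  rw [mor₃_eq_zero_of_retraction hT hr, zero_comp]

omit [HasZeroObject C] [Pretriangulated C] in
lemma finrank_end_shift_ne_zero (i : ι) (p : ℤ) :
    Module.finrank K ((L i)⟦p⟧ ⟶ (L i)⟦p⟧) ≠ 0 := by
  rw [Ne, finrank_hom_eq_zero_iff, homZero_shift_iff, ← finrank_hom_eq_zero_iff K,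
    hL.finrank_end]
  exact one_ne_zero

omit [HasZeroObject C] [Pretriangulated C] in
lemma finrank_eq_zero {i j : ι} {p q : ℤ} (h : ¬ (i = j ∧ p = q)) :
    Module.finrank K ((L i)⟦p⟧ ⟶ (L j)⟦q⟧) = 0 :=
  (finrank_hom_eq_zero_iff K).2 (hL.homZero h)

omit [HasZeroObject C] [Pretriangulated C] hL in
lemma finrank_shift_eq_zero_iff {i : ι} {p m : ℤ} {X : C} :
    Module.finrank K ((L i)⟦p⟧ ⟶ X⟦-m⟧) = 0 ↔ Module.finrank K ((L i)⟦p + m⟧ ⟶ X) = 0 := by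
  rw [finrank_hom_eq_zero_iff, finrank_hom_eq_zero_iff,
    homZero_shift_shift_iff (r := p + m) (s := 0) (by lia)]
  have e := (shiftFunctorZero C ℤ).app X
  exact ⟨fun h => h.of_iso (Iso.refl _) e, fun h => h.of_iso (Iso.refl _) e.symm⟩

lemma finrank_eq_ite_of_finrank_end_le_two (S : SerreFunctor K C) {X : C}
    (hX : ∀ A, InPerp L A → HomZero X A) (hX₂ : Module.finrank K (X ⟶ X) ≤ 2)
    {m : ℤ} (hm : m ≠ 0) (hXm : ¬ HomZero (X⟦m⟧) X) :
    ∃ (i : ι) (p : ℤ),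
      (∀ j, j ≠ i → ∀ r : ℤ, Module.finrank K ((L j)⟦r⟧ ⟶ X) = 0) ∧
      ∀ r : ℤ, Module.finrank K ((L i)⟦r⟧ ⟶ X) = if r = p ∨ r = p + m then 1 else 0 := by
  have hzero : ∀ {Y : C}, HomZero Y Y → ∀ W : C,
      Module.finrank K (W ⟶ Y) = 0 ∧ Module.finrank K (Y ⟶ W) = 0 := fun {Y} hY W =>
    ⟨(finrank_hom_eq_zero_iff K).2 fun f => by rw [← Category.comp_id f, hY (𝟙 Y), comp_zero],
      (finrank_hom_eq_zero_iff K).2 fun f => by rw [← Category.id_comp f, hY (𝟙 Y), zero_comp]⟩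
  rw [← homZero_shift_right_iff (neg_add_cancel m), ← finrank_hom_eq_zero_iff K] at hXm
  have hX₀ : ¬ HomZero X X := fun h => hXm (hzero h _).2
  obtain ⟨i, p, Y, hY, hYr, hYl⟩ := hL.exists_summand S hX hX₀
  have hY₀ : ¬ HomZero Y Y := fun h => hXm (by
    rw [hYl, (hzero h _).2, add_zero, finrank_shift_eq_zero_iff, hYr, (hzero h _).1, add_zero]
    exact hL.finrank_eq_zero (by lia))
  obtain ⟨j, q, Z, hZ, hZr, hZl⟩ := hL.exists_summand S hY hY₀
  have h₁ := hL.finrank_end_shift_ne_zero i p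
  have h₂ := hL.finrank_end_shift_ne_zero j q
  have hXX := hYl X
  rw [hYr, hYr ((L i)⟦p⟧), hYr Y, hZr ((L i)⟦p⟧), hZr Y, hZl ((L j)⟦q⟧), hZl Z] at hXX
  rw [hYr] at hX₂
  have hZ₀ : HomZero Z Z := (finrank_hom_eq_zero_iff K).1 (by lia)
  have hr : ∀ W : C, Module.finrank K (W ⟶ X) =
      Module.finrank K (W ⟶ (L i)⟦p⟧) + Module.finrank K (W ⟶ (L j)⟦q⟧) := fun W => by
    rw [hYr, hZr, (hzero hZ₀ W).1, add_zero]
  have hl : ∀ W : C, Module.finrank K (X ⟶ W) =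
      Module.finrank K ((L i)⟦p⟧ ⟶ W) + Module.finrank K ((L j)⟦q⟧ ⟶ W) := fun W => by
    rw [hYl, hZl, (hzero hZ₀ W).2, add_zero]
  have hi : Module.finrank K ((L i)⟦p⟧ ⟶ (L i)⟦p⟧) = 1 := by lia
  have hj : Module.finrank K ((L j)⟦q⟧ ⟶ (L j)⟦q⟧) = 1 := by lia
  have hne : ¬ (i = j ∧ p = q) := by
    rintro ⟨rfl, rfl⟩
    lia
  have hpq : i = j ∧ (q = p + m ∨ p = q + m) := by
    by_contra h
    refine hXm ?_
    rw [hl, Nat.add_eq_zero_iff, finrank_shift_eq_zero_iff, finrank_shift_eq_zero_iff, hr, hr,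
      hL.finrank_eq_zero (by lia), hL.finrank_eq_zero (by grind),
      hL.finrank_eq_zero (by grind), hL.finrank_eq_zero (by lia)]
    exact ⟨rfl, rfl⟩
  obtain ⟨rfl, hpq⟩ := hpq
  have key : ∀ r : ℤ, Module.finrank K ((L i)⟦r⟧ ⟶ X) = if r = p ∨ r = q then 1 else 0 := by
    intro r
    rw [hr]
    by_cases hrp : r = p
    · subst hrp
      rw [hi, hL.finrank_eq_zero hne]
      simp
    · rw [hL.finrank_eq_zero (j := i) (q := p) (by lia)]
      by_cases hrq : r = q
      · subst hrq
        rw [hj]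
        simp
      · rw [hL.finrank_eq_zero (by lia)]
        simp [hrp, hrq]
  have hother : ∀ j, j ≠ i → ∀ r : ℤ, Module.finrank K ((L j)⟦r⟧ ⟶ X) = 0 := fun j hj r => by
    rw [hr, hL.finrank_eq_zero (fun h => hj h.1), hL.finrank_eq_zero (fun h => hj h.1)]
  rcases hpq with rfl | rfl
  · exact ⟨i, p, hother, key⟩
  · exact ⟨i, q, hother, fun r => by rw [key]; simp only [or_comm]⟩

end IsOrthogonalExceptional

end Shift

end PretriangulatedLemmas

/-- Let `𝒜 = ⟨𝒦, L₁, …, L_N⟩` be an `m`-Enriques category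
(`S² ≅ [n]` with `n = 2m ≥ 3`) with `{Lᵢ}` an orthogonal exceptional collection,
and `F` a `(2m−1)`-spherical object of `𝒦` (the spherical condition
`S_𝒦(F) ≅ F[2m−1]` being encoded by the Serre-duality isomorphisms
`Hom(F, A[p]) ≅ Hom(A, F[2m−1−p])^∨` for all `A ∈ 𝒦`). Then there is exactly one
index `i` with `RHom(F, Lᵢ) ≠ 0`, and for that `i`,
`RHom(F, Lᵢ) ≅ K[k−2m+1] ⊕ K[k]` for some integer `k`. -/
theorem stmt13 {K : Type*} [Field K] {C : Type u} [Category.{v} C]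
    [Preadditive C] [CategoryTheory.Linear K C] [HasZeroObject C] [HasShift C ℤ]
    [∀ n : ℤ, (CategoryTheory.shiftFunctor C n).Additive] [Pretriangulated C]
    [∀ A B : C, FiniteDimensional K (A ⟶ B)]
    (n : ℤ) (hn : 3 ≤ n)
    (S : SerreFunctor K C)
    (hCY : Nonempty (S.S ⋙ S.S ≅ CategoryTheory.shiftFunctor C n))
    {N : ℕ} (hN : 1 ≤ N) (L : Fin N → C)
    (hexc0 : ∀ i, Module.finrank K (L i ⟶ L i) = 1)
    (hexcp : ∀ i, ∀ p : ℤ, p ≠ 0 → ∀ f : L i ⟶ (L i)⟦p⟧, f = 0)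
    (horth : ∀ i j, i ≠ j → ∀ p : ℤ, ∀ f : L i ⟶ (L j)⟦p⟧, f = 0)
    (F : C)
    (hFK : ∀ (i : Fin N) (p : ℤ) (f : L i ⟶ F⟦p⟧), f = 0)
    (hsph : ∀ p : ℤ,
      Module.finrank K (F ⟶ F⟦p⟧) = if p = 0 ∨ p = n - 1 then 1 else 0)
    (hserreK : ∀ A : C, (∀ (i : Fin N) (p : ℤ) (f : L i ⟶ A⟦p⟧), f = 0) →
      ∀ p : ℤ,
        Nonempty ((F ⟶ A⟦p⟧) ≃ₗ[K] Module.Dual K (A ⟶ F⟦n - 1 - p⟧))) :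
    ∃ i : Fin N,
      (∀ j : Fin N, j ≠ i → ∀ (p : ℤ) (f : F ⟶ (L j)⟦p⟧), f = 0) ∧
      ∃ k : ℤ, ∀ p : ℤ,
        Module.finrank K (F ⟶ (L i)⟦p⟧) =
          if p = k ∨ p = k + n - 1 then 1 else 0 := by
  have hL : IsOrthogonalExceptional K L := ⟨hexc0, hexcp, horth⟩
  have eF : F⟦n - 1⟧⟦(1 : ℤ)⟧ ≅ F⟦n⟧ := ((shiftFunctorAdd' C (n - 1) 1 n (by lia)).app F).symm
  have e₀ : ∀ A : C, A⟦(0 : ℤ)⟧ ≅ A := (shiftFunctorZero C ℤ).app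
  have hFF : ∀ p : ℤ, p ≠ 0 → p ≠ n - 1 → HomZero F (F⟦p⟧) := fun p h₀ h₁ => by
    rw [← finrank_hom_eq_zero_iff K, hsph, if_neg (by lia)]
  have hEnd : Module.finrank K (F ⟶ F) = 1 := by
    rw [← (Linear.homCongr K (Iso.refl F) (e₀ F)).finrank_eq, hsph, if_pos (Or.inl rfl)]
  have hFE : Module.finrank K (F ⟶ F⟦n - 1⟧) = 1 := by rw [hsph, if_pos (Or.inr rfl)]
  have hF : IsSphericalPair K L F (F⟦n - 1⟧) :=
    { inPerp := inPerp_of_homZero_shift hFK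
      finrank_end := hEnd
      finrank_hom := hFE
      homZero_shift := (hFF n (by lia) (by lia)).of_iso (Iso.refl _) eF.symm
      finrank_eq := fun X hX => by
        obtain ⟨e⟩ := hserreK X hX.homZero_shift 0
        rw [sub_zero] at e
        rw [← (Linear.homCongr K (Iso.refl F) (e₀ X)).finrank_eq, e.finrank_eq,
          Subspace.dual_finrank_eq] }
  have κ : S.S.obj (S.S.obj F) ≅ F⟦n - 1⟧⟦(1 : ℤ)⟧ := hCY.some.app F ≪≫ eF.symm
  obtain ⟨w, hw⟩ : ∃ w : S.S.obj F ⟶ F⟦(1 : ℤ)⟧, w ≠ 0 := by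
    by_contra! h
    have h₁ := (S.homZero_iff.1 h).of_iso (Iso.refl _) κ
    rw [homZero_shift_iff, ← finrank_hom_eq_zero_iff K, hFE] at h₁
    exact one_ne_zero h₁
  obtain ⟨T, a, b, hT⟩ := distinguished_cocone_triangle₂ w
  have hTK : ∀ A, InPerp L A → HomZero T A := fun A hA => hF.homZero_of_distTriang κ hw hT hA
  have hT₂ : Module.finrank K (T ⟶ T) ≤ 2 := by
    have h₁ := finrank_hom_le_of_distTriang (K := K) hT T
    have h₂ := finrank_hom_le_of_distTriang (K := K) hT F
    rw [(finrank_hom_eq_zero_iff K).2 (hTK F hF.inPerp), ← S.finrank_eq] at h₁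
    rw [← S.finrank_eq, hEnd] at h₂
    lia
  have hTn : ¬ HomZero (T⟦1 - n⟧) T := fun h => by
    have h₁ : HomZero (T⟦1 - n⟧) (S.S.obj F) := fun y => by
      obtain ⟨x, rfl⟩ := exists_lift₃ hT y
        ((homZero_shift_right_iff (by lia)).1 (hTK _ ((hF.inPerp.shift 1).shift (n - 1))) _)
      rw [h x, zero_comp]
    have h₂ : HomZero (F⟦n - 1⟧) T := (homZero_shift_right_iff (by lia)).1 (S.homZero_iff.2 h₁)
    have h₃ : HomZero (F⟦n - 1⟧) (S.S.obj F) := fun y => by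
      obtain ⟨x, rfl⟩ := exists_lift₃ hT y
        ((homZero_shift_shift_iff (r := 0) (s := 2 - n) (by lia)).2
          ((hFF (2 - n) (by lia) (by lia)).of_iso (e₀ F).symm (Iso.refl _)) _)
      rw [h₂ x, zero_comp]
    have h₄ := (finrank_hom_eq_zero_iff K).2 (S.homZero_iff.2 h₃)
    exact one_ne_zero (hFE.symm.trans h₄)
  have hFL : ∀ j (r : ℤ), Module.finrank K (F ⟶ (L j)⟦r⟧) =
      Module.finrank K ((L j)⟦r⟧ ⟶ T) := fun j r => by
    have h₁ := finrank_hom_le_of_distTriang (K := K) hT ((L j)⟦r⟧)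
    have h₂ : Module.finrank K ((L j)⟦r⟧ ⟶ S.S.obj F) ≤
        Module.finrank K ((L j)⟦r⟧ ⟶ T) + Module.finrank K ((L j)⟦r⟧ ⟶ F⟦(1 : ℤ)⟧) := by
      exact finrank_hom_le_of_distTriang (rot_of_distTriang _ hT) ((L j)⟦r⟧)
    rw [(finrank_hom_eq_zero_iff K).2 (hF.inPerp j r)] at h₁
    rw [(finrank_hom_eq_zero_iff K).2 (hF.inPerp.shift 1 j r)] at h₂
    rw [S.finrank_eq]
    lia
  obtain ⟨i, p, hne, hi⟩ :=
    hL.finrank_eq_ite_of_finrank_end_le_two S hTK hT₂ (m := 1 - n) (by lia) hTn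
  refine ⟨i, fun j hj r => (finrank_hom_eq_zero_iff K).1 (by rw [hFL, hne j hj]),
    p + (1 - n), fun r => ?_⟩
  rw [hFL, hi]
  exact if_congr (by lia) rfl rfl
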